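/- arXiv:2108.03105 — 3 statements merged into one kernel-verified Lean document; each statement's English description precedes it below -/
import Mathlib

section
/- Let m₁,…,m_r be integers. Then the tridiagonal determinant is invariant under 'blowup insertion': for 1 ≤ i ≤ r−1, det(m₁,…,m_r) = det(m₁,…,m_{i−1}, m_i + 1, 1, m_{i+1} + 1, m_{i+2},…,m_r); moreover at the two ends, det(m₁,…,m_r) = det(1, m₁ + 1, m₂,…,m_r) and det(m₁,…,m_r) = det(m₁,…,m_{r−1}, m_r + 1, 1). -/
/-- The r×r tridiagonal matrix with diagonal entries given by the list `m` and
all sub- and super-diagonal entries equal to `-1`. -/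
def tridiag (m : List ℤ) : Matrix (Fin m.length) (Fin m.length) ℤ :=
  Matrix.of fun i j =>
    if (i : ℕ) = (j : ℕ) then m.get i
    else if (i : ℕ) + 1 = (j : ℕ) ∨ (j : ℕ) + 1 = (i : ℕ) then -1 else 0

/-- `tridet [m₁,…,m_r] = det(m₁,…,m_r)`, the determinant of the tridiagonal matrix;
the empty sequence has determinant 1 (the determinant of the empty matrix). -/
def tridet (m : List ℤ) : ℤ := (tridiag m).det

@[simp]
theorem tridet_nil : tridet [] = 1 := Matrix.det_fin_zero (A := tridiag [])

@[simp]
theorem tridet_singleton (x : ℤ) : tridet [x] = x :=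
  Matrix.det_fin_one (tridiag [x])

theorem tridiag_cons_submatrix_succ (x : ℤ) (l : List ℤ) :
    (tridiag (x :: l)).submatrix (Fin.succ : Fin l.length → Fin (l.length + 1)) Fin.succ =
      tridiag l := by
  ext i j
  simp [tridiag]

/-- The three-term recursion for tridiagonal determinants. -/
theorem tridet_cons_cons (x y : ℤ) (l : List ℤ) :
    tridet (x :: y :: l) = x * tridet (y :: l) - tridet l := by
  let A : Matrix (Fin (l.length + 2)) (Fin (l.length + 2)) ℤ := tridiag (x :: y :: l)
  have hrow (j : Fin l.length) : A 0 j.succ.succ = 0 := by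
    simp [A, tridiag]
  have hcol (i : Fin l.length) : A i.succ.succ 0 = 0 := by
    simp [A, tridiag]
  have h00 : A 0 0 = x := by simp [A, tridiag]
  have h01 : A 0 1 = -1 := by simp [A, tridiag]
  have h10 : A 1 0 = -1 := by simp [A, tridiag]
  have hs : A.submatrix Fin.succ Fin.succ = tridiag (y :: l) :=
    tridiag_cons_submatrix_succ x (y :: l)
  have hss : A.submatrix (fun i : Fin l.length => i.succ.succ) (fun j => j.succ.succ) =
      tridiag l := by
    rw [← tridiag_cons_submatrix_succ y l, ← hs]
    rfl
  have hminor : (A.submatrix Fin.succ (Fin.succAbove 1)).det = -tridet l := by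
    have hsub : (A.submatrix Fin.succ (Fin.succAbove 1)).submatrix
        (Fin.succAbove 0) Fin.succ = tridiag l := by
      rw [← hss]
      ext i j
      simp
    rw [Matrix.det_succ_column_zero, Fin.sum_univ_succ, hsub]
    simp [h10, hcol, tridet]
  change A.det = _
  rw [Matrix.det_succ_row_zero, Fin.sum_univ_succ, Fin.sum_univ_succ]
  simp only [Fin.succ_zero_eq_one, hminor, hrow, h00, h01, Fin.succAbove_zero, hs]
  simp [tridet]
  ring

/-- Prepending a common prefix preserves equality of tridiagonal determinants, as soon as
it holds for prefixes of length at most one. -/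
theorem tridet_append_congr {l l' : List ℤ} (h : tridet l = tridet l')
    (hcons : ∀ z, tridet (z :: l) = tridet (z :: l')) (a : List ℤ) :
    tridet (a ++ l) = tridet (a ++ l') := by
  induction a using List.twoStepInduction with
  | nil => exact h
  | singleton z => exact hcons z
  | cons_cons z w a ih ih' =>
    simp only [List.cons_append] at ih' ⊢
    rw [tridet_cons_cons, tridet_cons_cons, ih, ih']

theorem tridet_add_one_cons (x : ℤ) (l : List ℤ) :
    tridet ((x + 1) :: l) = tridet (x :: l) + tridet l := by
  cases l with
  | nil => simp
  | cons y l => rw [tridet_cons_cons, tridet_cons_cons]; ring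

theorem tridet_one_cons_add_one_cons (x : ℤ) (l : List ℤ) :
    tridet (1 :: (x + 1) :: l) = tridet (x :: l) := by
  rw [tridet_cons_cons, tridet_add_one_cons]
  ring

theorem stmt2 :
    (∀ (a b : List ℤ) (x y : ℤ),
        tridet (a ++ x :: y :: b) = tridet (a ++ (x + 1) :: 1 :: (y + 1) :: b)) ∧
    (∀ (b : List ℤ) (x : ℤ),
        tridet (x :: b) = tridet (1 :: (x + 1) :: b)) ∧
    (∀ (a : List ℤ) (x : ℤ),
        tridet (a ++ [x]) = tridet (a ++ [x + 1, 1])) := by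
  refine ⟨fun a b x y => ?_, fun b x => (tridet_one_cons_add_one_cons x b).symm, fun a x => ?_⟩
  · have h : tridet (x :: y :: b) = tridet ((x + 1) :: 1 :: (y + 1) :: b) := by
      rw [tridet_cons_cons, tridet_cons_cons, tridet_one_cons_add_one_cons, tridet_add_one_cons]
      ring
    refine tridet_append_congr h (fun z => ?_) a
    rw [tridet_cons_cons z, tridet_cons_cons z, h, tridet_one_cons_add_one_cons]
  · have h : tridet [x] = tridet [x + 1, 1] := by simp [tridet_cons_cons]
    refine tridet_append_congr h (fun z => ?_) a
    rw [tridet_cons_cons z, tridet_cons_cons z, h]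
    simp
end

section
/- Let r ≥ 0 and let m₁,…,m_r be integers. Let e₀,…,e_{r+1} be the standard basis of ℤ^{r+2} and let K ≤ ℤ^{r+2} be the subgroup generated by the elements e_{i−1} − m_i e_i + e_{i+1} for 1 ≤ i ≤ r. Then the quotient ℤ^{r+2}/K is a torsion-free abelian group (indeed free of rank 2). Consequently, if ν : ℤ^{r+2} → ℤ² is any surjective group homomorphism with K ⊆ ker ν, then ker ν = K. -/
/-- The vectors of `ℤ²` determined by `v₀ = e₀`, `v₁ = e₁` and `v_{n+2} = c_n v_{n+1} - v_n`. -/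
def hjSequence (c : ℕ → ℤ) : ℕ → Fin 2 → ℤ
  | 0 => ![1, 0]
  | 1 => ![0, 1]
  | n + 2 => c n • hjSequence c (n + 1) - hjSequence c n

/-- A sequence obeying the recurrence is determined linearly by its first two terms. -/
lemma eq_hjSequence_smul_add {M : Type*} [AddCommGroup M] (c : ℕ → ℤ) (w : ℕ → M) (N : ℕ)
    (hw : ∀ n < N, w (n + 2) = c n • w (n + 1) - w n) :
    ∀ n < N + 2, w n = hjSequence c n 0 • w 0 + hjSequence c n 1 • w 1
  | 0, _ => by simp [hjSequence]
  | 1, _ => by simp [hjSequence]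
  | n + 2, h => by
    rw [hw n (by omega)]
    nth_rw 1 [eq_hjSequence_smul_add c w N hw (n + 1) (by omega),
      eq_hjSequence_smul_add c w N hw n (by omega)]
    simp only [hjSequence, Pi.sub_apply, Pi.smul_apply, smul_eq_mul]
    module

/-- The quotient by the relation lattice of a Hirzebruch–Jung string is isomorphic to `ℤ²`. -/
lemma nonempty_quotient_relations_equiv (r : ℕ) (m : Fin r → ℤ)
    (K : Submodule ℤ (Fin (r + 2) → ℤ))
    (hK : K = Submodule.span ℤ (Set.range fun i : Fin r =>
      (Pi.single i.castSucc.castSucc (1 : ℤ) : Fin (r + 2) → ℤ)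
        - m i • (Pi.single i.succ.castSucc (1 : ℤ) : Fin (r + 2) → ℤ)
        + (Pi.single i.succ.succ (1 : ℤ) : Fin (r + 2) → ℤ))) :
    Nonempty (((Fin (r + 2) → ℤ) ⧸ K) ≃ₗ[ℤ] (Fin 2 → ℤ)) := by
  let c : ℕ → ℤ := fun n => if h : n < r then m ⟨n, h⟩ else 0
  let g : (Fin (r + 2) → ℤ) →ₗ[ℤ] (Fin 2 → ℤ) :=
    Fintype.linearCombination ℤ fun i : Fin (r + 2) => hjSequence c i
  have hg : ∀ i, g (Pi.single i 1) = hjSequence c i := fun i => by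
    simp [g, Fintype.linearCombination_apply_single]
  have hKg : K ≤ LinearMap.ker g := by
    rw [hK, Submodule.span_le]
    rintro _ ⟨i, rfl⟩
    simp only [SetLike.mem_coe, LinearMap.mem_ker, map_add, map_sub, map_smul, hg,
      Fin.val_castSucc, Fin.val_succ, hjSequence]
    simp [c]
  let w : ℕ → (Fin (r + 2) → ℤ) ⧸ K := fun n =>
    if h : n < r + 2 then K.mkQ (Pi.single ⟨n, h⟩ 1) else 0
  have hw : ∀ n < r, w (n + 2) = c n • w (n + 1) - w n := by
    intro n hn
    have hmem : K.mkQ _ = 0 := (Submodule.Quotient.mk_eq_zero K).2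
      (hK ▸ Submodule.subset_span (Set.mem_range_self (⟨n, hn⟩ : Fin r)))
    simp only [map_add, map_sub, map_smul] at hmem
    simp only [w, c, hn, show n + 2 < r + 2 by omega, show n + 1 < r + 2 by omega,
      show n < r + 2 by omega, dif_pos]
    rw [← sub_eq_zero, ← hmem]
    simp only [Fin.castSucc_mk, Fin.succ_mk]
    abel
  have hmk : ∀ x, K.mkQ x = g x 0 • w 0 + g x 1 • w 1 := by
    let f : (Fin (r + 2) → ℤ) →ₗ[ℤ] (Fin (r + 2) → ℤ) ⧸ K :=
      (Fintype.linearCombination ℤ ![w 0, w 1]) ∘ₗ g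
    have hf : K.mkQ = f := by
      refine LinearMap.pi_ext' fun i => LinearMap.ext_ring ?_
      have := eq_hjSequence_smul_add c w r hw i i.isLt
      simpa [f, hg, w, Fintype.linearCombination_apply, Fin.sum_univ_two] using this
    intro x
    rw [hf]
    simp [f, Fintype.linearCombination_apply, Fin.sum_univ_two]
  have hker : LinearMap.ker g = K := by
    refine le_antisymm (fun x hx => ?_) hKg
    rw [← Submodule.Quotient.mk_eq_zero, ← Submodule.mkQ_apply, hmk, LinearMap.mem_ker.1 hx]
    simp
  have hsurj : Function.Surjective g := by
    intro y
    refine ⟨y 0 • Pi.single 0 1 + y 1 • Pi.single 1 1, ?_⟩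
    rw [map_add, map_smul, map_smul, hg, hg]
    ext j
    fin_cases j <;> simp [hjSequence]
  exact ⟨(Submodule.quotEquivOfEq _ _ hker.symm).trans (g.quotKerEquivOfSurjective hsurj)⟩

theorem stmt6 (r : ℕ) (m : Fin r → ℤ)
    (K : Submodule ℤ (Fin (r + 2) → ℤ))
    (hK : K = Submodule.span ℤ (Set.range fun i : Fin r =>
      (Pi.single i.castSucc.castSucc (1 : ℤ) : Fin (r + 2) → ℤ)
        - m i • (Pi.single i.succ.castSucc (1 : ℤ) : Fin (r + 2) → ℤ)
        + (Pi.single i.succ.succ (1 : ℤ) : Fin (r + 2) → ℤ))) :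
    NoZeroSMulDivisors ℤ ((Fin (r + 2) → ℤ) ⧸ K) ∧
    Module.Free ℤ ((Fin (r + 2) → ℤ) ⧸ K) ∧
    Module.finrank ℤ ((Fin (r + 2) → ℤ) ⧸ K) = 2 ∧
    ∀ ν : (Fin (r + 2) → ℤ) →ₗ[ℤ] (Fin 2 → ℤ),
      Function.Surjective ν → K ≤ LinearMap.ker ν → LinearMap.ker ν = K := by
  obtain ⟨e⟩ := nonempty_quotient_relations_equiv r m K hK
  have hfree : Module.Free ℤ ((Fin (r + 2) → ℤ) ⧸ K) := Module.Free.of_equiv e.symm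
  refine ⟨⟨fun {n x} h => ?_⟩, hfree, by simp [e.finrank_eq], fun ν hν hKν => ?_⟩
  · exact smul_eq_zero.1 h
  · have hsurj : Function.Surjective (K.liftQ ν hKν ∘ₗ e.symm.toLinearMap) := by
      intro y
      obtain ⟨x, rfl⟩ := hν y
      exact ⟨e (K.mkQ x), by simp⟩
    have hinj := OrzechProperty.injective_of_surjective_endomorphism _ hsurj
    refine le_antisymm (fun x hx => ?_) hKν
    rw [← Submodule.Quotient.mk_eq_zero, ← e.map_eq_zero_iff]
    apply hinj
    simpa using hx
end

section
/- Let r ≥ 0, let m₁,…,m_r be integers, and let ν : ℤ^{r+2} → ℤ² be a surjective group homomorphism satisfying ν(e_{i−1}) − m_i ν(e_i) + ν(e_{i+1}) = 0 for all 1 ≤ i ≤ r, where e₀,…,e_{r+1} is the standard basis. Let A be an abelian group and let δ : {0,1,…,r+1} → A satisfy δ(i−1) − m_i δ(i) + δ(i+1) = 0 for all 1 ≤ i ≤ r. Then there exists a unique group homomorphism δ̄ : ℤ² → A such that δ(i) = δ̄(ν(e_i)) for all 0 ≤ i ≤ r+1. -/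
/-- A solution of a three-term recurrence whose first two values lie in a subgroup takes
all its values in that subgroup. -/
theorem mem_of_threeTerm {r : ℕ} {m : Fin r → ℤ} {B : Type*} [AddCommGroup B]
    {f : Fin (r + 2) → B}
    (hf : ∀ i : Fin r,
      f i.castSucc.castSucc - m i • f i.succ.castSucc + f i.succ.succ = 0)
    (H : AddSubgroup B) (h0 : f 0 ∈ H) (h1 : f 1 ∈ H) (i : Fin (r + 2)) : f i ∈ H := by
  obtain ⟨n, hn⟩ := i
  induction n using Nat.twoStepInduction with
  | zero => exact h0
  | one => exact h1
  | more n ih₀ ih₁ =>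
    have h := hf ⟨n, by omega⟩
    have hmem := H.neg_mem (H.sub_mem (ih₀ (by omega))
      (H.zsmul_mem (ih₁ (by omega)) (m ⟨n, by omega⟩)))
    exact (neg_eq_of_add_eq_zero_right h) ▸ hmem

/-- Two solutions of a three-term recurrence with the same first two values are equal. -/
theorem eq_of_threeTerm {r : ℕ} {m : Fin r → ℤ} {B : Type*} [AddCommGroup B]
    {f g : Fin (r + 2) → B}
    (hf : ∀ i : Fin r,
      f i.castSucc.castSucc - m i • f i.succ.castSucc + f i.succ.succ = 0)
    (hg : ∀ i : Fin r,
      g i.castSucc.castSucc - m i • g i.succ.castSucc + g i.succ.succ = 0)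
    (h0 : f 0 = g 0) (h1 : f 1 = g 1) : f = g := by
  have hfg : ∀ i : Fin r,
      (f - g) i.castSucc.castSucc - m i • (f - g) i.succ.castSucc
        + (f - g) i.succ.succ = 0 := by
    intro i
    have h := congrArg₂ (· - ·) (hf i) (hg i)
    simp only [sub_zero] at h
    rw [← h]
    simp only [Pi.sub_apply, smul_sub]
    abel
  funext i
  have := mem_of_threeTerm hfg ⊥ (by simp [h0]) (by simp [h1]) i
  simpa [sub_eq_zero] using this

/-- The homomorphism `ℤ × ℤ →+ B` sending `(x, y)` to `x • a + y • b`. -/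
def zsmulPair {B : Type*} [AddCommGroup B] (a b : B) : ℤ × ℤ →+ B :=
  (zmultiplesHom B a).coprod (zmultiplesHom B b)

theorem zsmulPair_apply {B : Type*} [AddCommGroup B] (a b : B) (p : ℤ × ℤ) :
    zsmulPair a b p = p.1 • a + p.2 • b := rfl

theorem stmt9 (r : ℕ) (m : Fin r → ℤ)
    (ν : (Fin (r + 2) → ℤ) →+ ℤ × ℤ) (hν : Function.Surjective ν)
    (hrel : ∀ i : Fin r,
      ν (Pi.single i.castSucc.castSucc (1 : ℤ))
        - m i • ν (Pi.single i.succ.castSucc (1 : ℤ))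
        + ν (Pi.single i.succ.succ (1 : ℤ)) = 0)
    (A : Type*) [AddCommGroup A] (δ : Fin (r + 2) → A)
    (hδ : ∀ i : Fin r,
      δ i.castSucc.castSucc - m i • δ i.succ.castSucc + δ i.succ.succ = 0) :
    ∃! δbar : ℤ × ℤ →+ A, ∀ i : Fin (r + 2), δ i = δbar (ν (Pi.single i (1 : ℤ))) := by
  set a := ν (Pi.single 0 (1 : ℤ)) with ha
  set b := ν (Pi.single 1 (1 : ℤ)) with hb
  have hsurj : Function.Surjective (zsmulPair a b) := by
    intro p
    obtain ⟨x, rfl⟩ := hν p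
    change ν x ∈ (zsmulPair a b).range
    rw [← Finset.univ_sum_single x, map_sum]
    refine AddSubgroup.sum_mem _ fun i _ => ?_
    have hsingle : (Pi.single i (x i) : Fin (r + 2) → ℤ) = x i • Pi.single i (1 : ℤ) := by
      rw [← Pi.single_smul, smul_eq_mul, mul_one]
    rw [hsingle, map_zsmul]
    refine AddSubgroup.zsmul_mem _ ?_ _
    exact mem_of_threeTerm (f := fun i => ν (Pi.single i (1 : ℤ))) hrel _
      (AddMonoidHom.mem_range.2 ⟨(1, 0), by simp [zsmulPair_apply, ha]⟩)
      (AddMonoidHom.mem_range.2 ⟨(0, 1), by simp [zsmulPair_apply, hb]⟩) i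
  have hinj : Function.Injective (zsmulPair a b) :=
    OrzechProperty.injective_of_surjective_endomorphism
      (zsmulPair a b).toIntLinearMap hsurj
  let e : ℤ × ℤ ≃+ ℤ × ℤ := AddEquiv.ofBijective (zsmulPair a b) ⟨hinj, hsurj⟩
  have hea : e.symm a = (1, 0) := by
    refine (AddEquiv.symm_apply_eq e).2 (?_ : a = zsmulPair a b (1, 0))
    simp [zsmulPair_apply]
  have heb : e.symm b = (0, 1) := by
    refine (AddEquiv.symm_apply_eq e).2 (?_ : b = zsmulPair a b (0, 1))
    simp [zsmulPair_apply]
  refine ⟨(zsmulPair (δ 0) (δ 1)).comp e.symm.toAddMonoidHom, ?_, ?_⟩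
  · refine congrFun (eq_of_threeTerm hδ (fun i => ?_) ?_ ?_)
    · rw [← map_zsmul, ← map_sub, ← map_add, hrel, map_zero]
    · simp [← ha, hea, zsmulPair_apply]
    · simp [← hb, heb, zsmulPair_apply]
  · intro φ hφ
    refine AddMonoidHom.ext fun p => ?_
    obtain ⟨q, rfl⟩ := hsurj p
    have h0 := hφ 0
    have h1 := hφ 1
    rw [← ha] at h0
    rw [← hb] at h1
    rw [zsmulPair_apply, map_add, map_add, map_zsmul, map_zsmul, map_zsmul, map_zsmul]
    simp [← h0, ← h1, hea, heb, zsmulPair_apply]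
end
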